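/- Let F be a 3-SAT formula with m ≥ 2 clauses over n variables, and let G_F be the graph constructed from F as described. Then F has a satisfying truth assignment if and only if γ_{r2}(G_F) = 2·γ_r(G_F). -/

import Mathlib

open Finset

section Defs

variable {V : Type*} [Fintype V] [DecidableEq V]

/-- A 2-rainbow dominating function: every vertex assigned `∅` sees both colors
in its neighborhood. -/
def IsRDF (G : SimpleGraph V) (f : V → Finset (Fin 2)) : Prop :=
  ∀ u, f u = ∅ → ∀ c : Fin 2, ∃ v, G.Adj u v ∧ c ∈ f v

/-- The weight of a 2-rainbow dominating function. -/
def rdfWeight (f : V → Finset (Fin 2)) : ℕ := ∑ u, (f u).card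

/-- The 2-rainbow domination number `γ_{r2}`. -/
noncomputable def gammaR2 (G : SimpleGraph V) : ℕ :=
  sInf {w | ∃ f, IsRDF G f ∧ rdfWeight f = w}

/-- A dominating set: every vertex outside has a neighbor inside. -/
def IsDominatingSet (G : SimpleGraph V) (D : Set V) : Prop :=
  ∀ u, u ∉ D → ∃ v ∈ D, G.Adj u v

/-- A weak Roman dominating function: `g : V → {0,1,2}` such that every vertex `u`
with `g u = 0` has a neighbor `v` with `g v ≥ 1` for which the set of vertices with
positive value under `g_{v→u}` is dominating. -/
def IsWRDF (G : SimpleGraph V) (g : V → ℕ) : Prop :=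
  (∀ x, g x ≤ 2) ∧
  ∀ u, g u = 0 → ∃ v, G.Adj u v ∧ 1 ≤ g v ∧
    IsDominatingSet G {x | 1 ≤ (if x = u then g u + 1 else if x = v then g v - 1 else g x)}

/-- The weight of a weak Roman dominating function. -/
def wrdfWeight (g : V → ℕ) : ℕ := ∑ u, g u

/-- The weak Roman domination number `γ_r`. -/
noncomputable def gammaR (G : SimpleGraph V) : ℕ :=
  sInf {w | ∃ g, IsWRDF G g ∧ wrdfWeight g = w}

end Defs


/-- The vertex type of the graph `G_F` associated with a 3-SAT formula with `n`
variables and `m` clauses: a copy of `K₄` for each variable (the vertices labelled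
`0` and `1` playing the roles of the literals `xᵢ` and `x̄ᵢ`), one vertex per
clause, and the two vertices `a` and `b`. -/
abbrev SatVert (n m : ℕ) := (Fin n × Fin 4) ⊕ (Fin m ⊕ Fin 2)

/-- The base relation for the graph `G_F`: each variable gadget is complete,
literal vertices are joined to the clauses containing them, and `a`, `b` are
joined to each other and to all clause vertices. -/
def satRel (n m : ℕ) (F : Fin m → Finset (Fin n ⊕ Fin n)) :
    SatVert n m → SatVert n m → Prop
  | Sum.inl (i, _), Sum.inl (i', _) => i = i'
  | Sum.inl (i, s), Sum.inr (Sum.inl j) =>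
      (s = 0 ∧ Sum.inl i ∈ F j) ∨ (s = 1 ∧ Sum.inr i ∈ F j)
  | Sum.inr (Sum.inl _), Sum.inr (Sum.inr _) => True
  | Sum.inr (Sum.inr _), Sum.inr (Sum.inr _) => True
  | _, _ => False

/-- The graph `G_F` associated with a 3-SAT formula `F`. -/
def satGraph (n m : ℕ) (F : Fin m → Finset (Fin n ⊕ Fin n)) :
    SimpleGraph (SatVert n m) :=
  SimpleGraph.fromRel (satRel n m F)

/-- A truth assignment `σ` satisfies `F` if every clause contains a true literal
(`Sum.inl i` is the literal `xᵢ`, `Sum.inr i` is the literal `x̄ᵢ`). -/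
def Satisfies {n m : ℕ} (σ : Fin n → Bool) (F : Fin m → Finset (Fin n ⊕ Fin n)) : Prop :=
  ∀ j, ∃ l ∈ F j, (match l with | Sum.inl i => σ i = true | Sum.inr i => σ i = false)


section Helpers

variable {n m : ℕ} {F : Fin m → Finset (Fin n ⊕ Fin n)}

lemma adj_KK (i i' : Fin n) (s s' : Fin 4) :
    (satGraph n m F).Adj (Sum.inl (i, s)) (Sum.inl (i', s')) ↔ i = i' ∧ s ≠ s' := by
  simp only [satGraph, SimpleGraph.fromRel_adj, satRel, ne_eq, Sum.inl.injEq, Prod.mk.injEq]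
  grind

lemma adj_KC (i : Fin n) (s : Fin 4) (j : Fin m) :
    (satGraph n m F).Adj (Sum.inl (i, s)) (Sum.inr (Sum.inl j)) ↔
      (s = 0 ∧ Sum.inl i ∈ F j) ∨ (s = 1 ∧ Sum.inr i ∈ F j) := by
  simp [satGraph, SimpleGraph.fromRel_adj, satRel]

lemma adj_KA (i : Fin n) (s : Fin 4) (t : Fin 2) :
    ¬ (satGraph n m F).Adj (Sum.inl (i, s)) (Sum.inr (Sum.inr t)) := by
  simp [satGraph, SimpleGraph.fromRel_adj, satRel]

lemma adj_AK (i : Fin n) (s : Fin 4) (t : Fin 2) :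
    ¬ (satGraph n m F).Adj (Sum.inr (Sum.inr t)) (Sum.inl (i, s)) := by
  simp [satGraph, SimpleGraph.fromRel_adj, satRel]

lemma adj_CC (j k : Fin m) :
    ¬ (satGraph n m F).Adj (Sum.inr (Sum.inl j)) (Sum.inr (Sum.inl k)) := by
  simp [satGraph, SimpleGraph.fromRel_adj, satRel]

lemma adj_CA (j : Fin m) (t : Fin 2) :
    (satGraph n m F).Adj (Sum.inr (Sum.inl j)) (Sum.inr (Sum.inr t)) := by
  simp [satGraph, SimpleGraph.fromRel_adj, satRel]

lemma adj_AC (j : Fin m) (t : Fin 2) :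
    (satGraph n m F).Adj (Sum.inr (Sum.inr t)) (Sum.inr (Sum.inl j)) := by
  simp [satGraph, SimpleGraph.fromRel_adj, satRel]

lemma adj_AA (t t' : Fin 2) (h : t ≠ t') :
    (satGraph n m F).Adj (Sum.inr (Sum.inr t)) (Sum.inr (Sum.inr t')) := by
  simp [satGraph, SimpleGraph.fromRel_adj, satRel, h]

/-- Neighbours of the unlabelled gadget vertices lie in the gadget. -/
lemma adj_K2 {i : Fin n} {v : SatVert n m}
    (h : (satGraph n m F).Adj (Sum.inl (i, 2)) v) : ∃ s, v = Sum.inl (i, s) := by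
  rcases v with ⟨i', s⟩ | j | t
  · rw [adj_KK] at h; exact ⟨s, by rw [h.1]⟩
  · rw [adj_KC] at h; simp at h
  · exact absurd h (adj_KA _ _ _)

lemma adj_K3 {i : Fin n} {v : SatVert n m}
    (h : (satGraph n m F).Adj (Sum.inl (i, 3)) v) : ∃ s, v = Sum.inl (i, s) := by
  rcases v with ⟨i', s⟩ | j | t
  · rw [adj_KK] at h; exact ⟨s, by rw [h.1]⟩
  · rw [adj_KC] at h; simp at h
  · exact absurd h (adj_KA _ _ _)

lemma adj_A {t : Fin 2} {v : SatVert n m}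
    (h : (satGraph n m F).Adj (Sum.inr (Sum.inr t)) v) : ∃ p, v = Sum.inr p := by
  rcases v with ⟨i', s⟩ | p
  · exact absurd h (adj_AK _ _ _)
  · exact ⟨p, rfl⟩

/-- Two colours present in a finite family give total size at least two. -/
lemma two_le_sum {ι : Type*} [Fintype ι] [DecidableEq ι] (f : ι → Finset (Fin 2))
    (h : ∀ c : Fin 2, ∃ v, c ∈ f v) : 2 ≤ ∑ v, (f v).card := by
  have h1 : (Finset.univ : Finset (Fin 2)) ⊆ Finset.univ.biUnion f := by
    intro c _
    obtain ⟨v, hv⟩ := h c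
    exact Finset.mem_biUnion.2 ⟨v, Finset.mem_univ _, hv⟩
  have h2 := (Finset.card_le_card h1).trans Finset.card_biUnion_le
  simpa using h2

lemma two_le_sum' {ι : Type*} [Fintype ι] [DecidableEq ι] (f : ι → Finset (Fin 2))
    (x y : ι) (hxy : x ≠ y) (hx : f x ≠ ∅) (hy : f y ≠ ∅) : 2 ≤ ∑ v, (f v).card := by
  have h1 : ∑ v ∈ ({x, y} : Finset ι), (f v).card ≤ ∑ v, (f v).card :=
    Finset.sum_le_sum_of_subset (Finset.subset_univ _)
  rw [Finset.sum_pair hxy] at h1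
  have := Finset.card_pos.2 (Finset.nonempty_iff_ne_empty.2 hx)
  have := Finset.card_pos.2 (Finset.nonempty_iff_ne_empty.2 hy)
  omega

lemma rdf_lower (f : SatVert n m → Finset (Fin 2)) (hf : IsRDF (satGraph n m F) f) :
    2 * n + 2 ≤ rdfWeight f := by
  have hK : ∀ i : Fin n, 2 ≤ ∑ s : Fin 4, (f (Sum.inl (i, s))).card := by
    intro i
    by_cases h2 : f (Sum.inl (i, 2)) = ∅
    · apply two_le_sum (fun s => f (Sum.inl (i, s)))
      intro c
      obtain ⟨v, hv, hc⟩ := hf _ h2 c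
      obtain ⟨s, rfl⟩ := adj_K2 hv
      exact ⟨s, hc⟩
    · by_cases h3 : f (Sum.inl (i, 3)) = ∅
      · apply two_le_sum (fun s => f (Sum.inl (i, s)))
        intro c
        obtain ⟨v, hv, hc⟩ := hf _ h3 c
        obtain ⟨s, rfl⟩ := adj_K3 hv
        exact ⟨s, hc⟩
      · exact two_le_sum' (fun s => f (Sum.inl (i, s))) 2 3 (by decide) h2 h3
  have hA : 2 ≤ ∑ p : Fin m ⊕ Fin 2, (f (Sum.inr p)).card := by
    by_cases h : ∃ t : Fin 2, f (Sum.inr (Sum.inr t)) = ∅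
    · obtain ⟨t, ht⟩ := h
      apply two_le_sum (fun p => f (Sum.inr p))
      intro c
      obtain ⟨v, hv, hc⟩ := hf _ ht c
      obtain ⟨s, rfl⟩ := adj_A hv
      exact ⟨s, hc⟩
    · push Not at h
      exact two_le_sum' (fun p => f (Sum.inr p)) (Sum.inr 0) (Sum.inr 1) (by simp)
        (h 0).ne_empty (h 1).ne_empty
  have hS : ∑ i : Fin n, 2 ≤ ∑ i : Fin n, ∑ s : Fin 4, (f (Sum.inl (i, s))).card :=
    Finset.sum_le_sum fun i _ => hK i
  simp only [Finset.sum_const, Finset.card_univ, Fintype.card_fin, smul_eq_mul] at hS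
  rw [rdfWeight, Fintype.sum_sum_type, Fintype.sum_prod_type]
  omega

lemma gammaR2_eq : gammaR2 (satGraph n m F) = 2 * n + 2 := by
  let f : SatVert n m → Finset (Fin 2) := fun v => match v with
    | Sum.inl (_, s) => if s = 0 then Finset.univ else ∅
    | Sum.inr (Sum.inl _) => ∅
    | Sum.inr (Sum.inr t) => {t}
  have hf : IsRDF (satGraph n m F) f := by
    rintro (⟨i, s⟩ | j | t) hu c
    · refine ⟨Sum.inl (i, 0), ?_, by simp [f]⟩
      rw [adj_KK]
      refine ⟨rfl, ?_⟩
      rintro rfl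
      simp only [f, if_true] at hu
      exact Finset.univ_nonempty.ne_empty hu
    · exact ⟨Sum.inr (Sum.inr c), adj_CA _ _, by simp [f]⟩
    · simp [f] at hu
  have hw : rdfWeight f = 2 * n + 2 := by
    rw [rdfWeight, Fintype.sum_sum_type, Fintype.sum_prod_type, Fintype.sum_sum_type]
    simp [f, Fin.sum_univ_four]
    omega
  refine le_antisymm (Nat.sInf_le ⟨f, hf, hw⟩) ?_
  refine le_csInf ⟨_, f, hf, hw⟩ ?_
  rintro w ⟨f', hf', rfl⟩
  exact rdf_lower f' hf'

lemma wrdf_K (g : SatVert n m → ℕ) (hg : IsWRDF (satGraph n m F) g) (i : Fin n) :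
    1 ≤ ∑ s : Fin 4, g (Sum.inl (i, s)) := by
  by_contra h
  have h0 : ∀ s : Fin 4, g (Sum.inl (i, s)) = 0 := by
    have : ∑ s : Fin 4, g (Sum.inl (i, s)) = 0 := by omega
    simpa using this
  obtain ⟨v, hv, h1, _⟩ := hg.2 _ (h0 2)
  obtain ⟨s, rfl⟩ := adj_K2 hv
  have := h0 s
  omega

lemma wrdf_A (g : SatVert n m → ℕ) (hg : IsWRDF (satGraph n m F) g) :
    1 ≤ ∑ p : Fin m ⊕ Fin 2, g (Sum.inr p) := by
  by_contra h
  have h0 : ∀ p : Fin m ⊕ Fin 2, g (Sum.inr p) = 0 := by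
    have h' : ∑ p : Fin m ⊕ Fin 2, g (Sum.inr p) = 0 := by omega
    intro p
    exact (Finset.sum_eq_zero_iff.1 h') p (Finset.mem_univ _)
  obtain ⟨v, hv, h1, _⟩ := hg.2 _ (h0 (Sum.inr 0))
  obtain ⟨s, rfl⟩ := adj_A hv
  have := h0 s
  omega

lemma wrdf_lower (g : SatVert n m → ℕ) (hg : IsWRDF (satGraph n m F) g) :
    n + 1 ≤ wrdfWeight g := by
  have hS : ∑ i : Fin n, 1 ≤ ∑ i : Fin n, ∑ s : Fin 4, g (Sum.inl (i, s)) :=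
    Finset.sum_le_sum fun i _ => wrdf_K g hg i
  simp only [Finset.sum_const, Finset.card_univ, Fintype.card_fin, smul_eq_mul] at hS
  have := wrdf_A g hg
  rw [wrdfWeight, Fintype.sum_sum_type, Fintype.sum_prod_type]
  omega

/-- A family of naturals with sum one has at most one positive member. -/
lemma sum_one_unique {ι : Type*} [Fintype ι] [DecidableEq ι] (w : ι → ℕ)
    (h : ∑ v, w v = 1) (x y : ι) (hx : 1 ≤ w x) (hy : 1 ≤ w y) : x = y := by
  by_contra hxy
  have h1 : ∑ v ∈ ({x, y} : Finset ι), w v ≤ ∑ v, w v :=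
    Finset.sum_le_sum_of_subset (Finset.subset_univ _)
  rw [Finset.sum_pair hxy] at h1
  omega

lemma sum_one_le {ι : Type*} [Fintype ι] (w : ι → ℕ)
    (h : ∑ v, w v = 1) (x : ι) : w x ≤ 1 :=
  h ▸ Finset.single_le_sum (f := w) (fun _ _ => Nat.zero_le _) (Finset.mem_univ x)

lemma sat_of_wrdf (hm : 2 ≤ m) (g : SatVert n m → ℕ) (hg : IsWRDF (satGraph n m F) g)
    (hw : wrdfWeight g = n + 1) : ∃ σ : Fin n → Bool, Satisfies σ F := by
  rw [wrdfWeight, Fintype.sum_sum_type, Fintype.sum_prod_type] at hw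
  have hA := wrdf_A g hg
  have hS : ∑ i : Fin n, 1 ≤ ∑ i : Fin n, ∑ s : Fin 4, g (Sum.inl (i, s)) :=
    Finset.sum_le_sum fun i _ => wrdf_K g hg i
  have hn : ∑ i : Fin n, 1 = n := by simp
  have hA1 : ∑ p : Fin m ⊕ Fin 2, g (Sum.inr p) = 1 := by omega
  have hK1 : ∀ i, ∑ s : Fin 4, g (Sum.inl (i, s)) = 1 := by
    have h1 : ∑ i : Fin n, 1 = ∑ i : Fin n, ∑ s : Fin 4, g (Sum.inl (i, s)) := by omega
    have h2 := (Finset.sum_eq_sum_iff_of_le fun i _ => wrdf_K g hg i).1 h1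
    exact fun i => (h2 i (Finset.mem_univ _)).symm
  -- a clause vertex of value zero can only be defended by `a` or `b`
  have key : ∀ j : Fin m, g (Sum.inr (Sum.inl j)) = 0 → ∃ t : Fin 2,
      1 ≤ g (Sum.inr (Sum.inr t)) ∧ IsDominatingSet (satGraph n m F)
        {x | 1 ≤ (if x = Sum.inr (Sum.inl j) then g (Sum.inr (Sum.inl j)) + 1
          else if x = Sum.inr (Sum.inr t) then g (Sum.inr (Sum.inr t)) - 1 else g x)} := by
    intro j hj
    obtain ⟨v, hv, h1, hd⟩ := hg.2 _ hj
    rcases v with ⟨i, s⟩ | k | t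
    · exfalso
      have hz : ∀ s', ¬ 1 ≤ (if (Sum.inl (i, s') : SatVert n m) = Sum.inr (Sum.inl j) then
          g (Sum.inr (Sum.inl j)) + 1
          else if (Sum.inl (i, s') : SatVert n m) = Sum.inl (i, s) then g (Sum.inl (i, s)) - 1
          else g (Sum.inl (i, s'))) := by
        intro s' h
        rw [if_neg (by simp)] at h
        split_ifs at h with hs
        · have := sum_one_le (fun s => g (Sum.inl (i, s))) (hK1 i) s
          omega
        · exact hs (by rw [sum_one_unique (fun s => g (Sum.inl (i, s))) (hK1 i) s' s h h1])
      obtain ⟨v, hv, ha⟩ := hd (Sum.inl (i, 2)) (hz 2)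
      obtain ⟨s', rfl⟩ := adj_K2 ha
      exact hz s' hv
    · exact absurd hv (adj_CC _ _)
    · exact ⟨t, h1, hd⟩
  have huniq := sum_one_unique (fun p => g (Sum.inr p)) hA1
  have hc0 : ∀ k, g (Sum.inr (Sum.inl k)) = 0 := by
    intro k
    by_contra hk
    have : Nontrivial (Fin m) := Fin.nontrivial_iff_two_le.2 hm
    obtain ⟨j, hjk⟩ := exists_ne k
    by_cases hj : g (Sum.inr (Sum.inl j)) = 0
    · obtain ⟨t, ht, _⟩ := key j hj
      have := huniq (Sum.inl k) (Sum.inr t) (Nat.one_le_iff_ne_zero.2 hk) ht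
      simp at this
    · have := huniq (Sum.inl k) (Sum.inl j) (Nat.one_le_iff_ne_zero.2 hk)
        (Nat.one_le_iff_ne_zero.2 hj)
      simp at this
      exact hjk this.symm
  refine ⟨fun i => decide (1 ≤ g (Sum.inl (i, 0))), ?_⟩
  intro k
  have : Nontrivial (Fin m) := Fin.nontrivial_iff_two_le.2 hm
  obtain ⟨j, hjk⟩ := exists_ne k
  obtain ⟨t, ht, hd⟩ := key j (hc0 j)
  obtain ⟨v, hv, ha⟩ := hd (Sum.inr (Sum.inl k)) (by
    simp [hc0, Ne.symm hjk])
  rcases v with ⟨i, s⟩ | l | t'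
  · have hv' : 1 ≤ g (Sum.inl (i, s)) := by simpa using hv
    rw [SimpleGraph.adj_comm, adj_KC] at ha
    rcases ha with ⟨rfl, hl⟩ | ⟨rfl, hl⟩
    · exact ⟨Sum.inl i, hl, by simpa using hv'⟩
    · refine ⟨Sum.inr i, hl, ?_⟩
      simp only [decide_eq_false_iff_not]
      intro h0
      have := sum_one_unique (fun s => g (Sum.inl (i, s))) (hK1 i) 0 1 h0 hv'
      simp at this
  · exact absurd ha (adj_CC _ _)
  · exfalso
    have h1 := sum_one_le (fun p => g (Sum.inr p)) hA1 (Sum.inr t)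
    simp only [Set.mem_ofPred_eq] at hv
    rw [if_neg (by simp)] at hv
    split_ifs at hv with h
    · omega
    · exact h (by rw [huniq (Sum.inr t') (Sum.inr t) hv ht])

lemma wrdf_of_sat (σ : Fin n → Bool) (hσ : Satisfies σ F) :
    ∃ g, IsWRDF (satGraph n m F) g ∧ wrdfWeight g = n + 1 := by
  let L : Fin n → Fin 4 := fun i => if σ i = true then 0 else 1
  let g : SatVert n m → ℕ := fun v => match v with
    | Sum.inl (i, s) => if s = L i then 1 else 0
    | Sum.inr (Sum.inl _) => 0
    | Sum.inr (Sum.inr t) => if t = 0 then 1 else 0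
  have gK : ∀ i s, g (Sum.inl (i, s)) = if s = L i then 1 else 0 := fun _ _ => rfl
  have gC : ∀ j, g (Sum.inr (Sum.inl j)) = 0 := fun _ => rfl
  have gA : ∀ t, g (Sum.inr (Sum.inr t)) = if t = 0 then 1 else 0 := fun _ => rfl
  have hcl : ∀ j, ∃ i, (satGraph n m F).Adj (Sum.inr (Sum.inl j)) (Sum.inl (i, L i)) := by
    intro j
    obtain ⟨l, hl, hs⟩ := hσ j
    rcases l with i | i
    · refine ⟨i, ?_⟩
      rw [SimpleGraph.adj_comm, adj_KC]
      left
      exact ⟨if_pos hs, hl⟩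
    · refine ⟨i, ?_⟩
      rw [SimpleGraph.adj_comm, adj_KC]
      right
      simp only at hs
      exact ⟨by simp [L, hs], hl⟩
  refine ⟨g, ⟨?_, ?_⟩, ?_⟩
  · rintro (⟨i, s⟩ | j | t)
    · rw [gK]; split_ifs <;> omega
    · rw [gC j]; omega
    · rw [gA]; split_ifs <;> omega
  · rintro (⟨i, s⟩ | j | t) hu
    · have hs : s ≠ L i := by
        rintro rfl
        simp [gK] at hu
      refine ⟨Sum.inl (i, L i), (adj_KK _ _ _ _).2 ⟨rfl, hs⟩, by simp [gK], ?_⟩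
      rintro (⟨i', s'⟩ | j | t) hx
      · by_cases hi : i' = i
        · subst hi
          refine ⟨Sum.inl (i', s), by simp, (adj_KK _ _ _ _).2 ⟨rfl, ?_⟩⟩
          rintro rfl
          simp at hx
        · refine ⟨Sum.inl (i', L i'), by simp [hi, gK], (adj_KK _ _ _ _).2 ⟨rfl, ?_⟩⟩
          rintro rfl
          simp [hi, gK] at hx
      · exact ⟨Sum.inr (Sum.inr 0), by simp [gA], adj_CA _ _⟩
      · refine ⟨Sum.inr (Sum.inr 0), by simp [gA], adj_AA _ _ ?_⟩
        rintro rfl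
        simp [gA] at hx
    · refine ⟨Sum.inr (Sum.inr 0), adj_CA _ _, by simp [gA], ?_⟩
      rintro (⟨i', s'⟩ | k | t) hx
      · refine ⟨Sum.inl (i', L i'), by simp [gK], (adj_KK _ _ _ _).2 ⟨rfl, ?_⟩⟩
        rintro rfl
        simp [gK] at hx
      · obtain ⟨i, hi⟩ := hcl k
        exact ⟨Sum.inl (i, L i), by simp [gK], hi⟩
      · exact ⟨Sum.inr (Sum.inl j), by simp, adj_AC _ _⟩
    · have ht : t ≠ 0 := by
        rintro rfl
        simp [gA] at hu
      refine ⟨Sum.inr (Sum.inr 0), adj_AA _ _ ht, by simp [gA], ?_⟩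
      rintro (⟨i', s'⟩ | k | t') hx
      · refine ⟨Sum.inl (i', L i'), by simp [gK], (adj_KK _ _ _ _).2 ⟨rfl, ?_⟩⟩
        rintro rfl
        simp [gK] at hx
      · exact ⟨Sum.inr (Sum.inr t), by simp, adj_CA _ _⟩
      · refine ⟨Sum.inr (Sum.inr t), by simp, adj_AA _ _ ?_⟩
        rintro rfl
        simp at hx
  · rw [wrdfWeight, Fintype.sum_sum_type, Fintype.sum_prod_type, Fintype.sum_sum_type]
    simp [gK, gC, gA]

end Helpers

/-- A 3-SAT formula `F` with `m ≥ 2` clauses over `n` variables is satisfiable iff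
`γ_{r2}(G_F) = 2 γ_r(G_F)`. -/
theorem satisfiable_iff_satGraph_extremal (n m : ℕ) (hm : 2 ≤ m)
    (F : Fin m → Finset (Fin n ⊕ Fin n)) (hF : ∀ j, (F j).card ≤ 3) :
    (∃ σ : Fin n → Bool, Satisfies σ F) ↔
      gammaR2 (satGraph n m F) = 2 * gammaR (satGraph n m F) := by
  rw [gammaR2_eq]
  constructor
  · rintro ⟨σ, hσ⟩
    obtain ⟨g, hg, hw⟩ := wrdf_of_sat σ hσ
    have h1 : gammaR (satGraph n m F) ≤ n + 1 := Nat.sInf_le ⟨g, hg, hw⟩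
    have h2 : n + 1 ≤ gammaR (satGraph n m F) := by
      refine le_csInf ⟨_, g, hg, hw⟩ ?_
      rintro w ⟨g', hg', rfl⟩
      exact wrdf_lower g' hg'
    omega
  · intro h
    have h1 : gammaR (satGraph n m F) = n + 1 := by omega
    have hne : {w | ∃ g, IsWRDF (satGraph n m F) g ∧ wrdfWeight g = w}.Nonempty := by
      by_contra hempty
      rw [Set.not_nonempty_iff_eq_empty] at hempty
      rw [gammaR, hempty, Nat.sInf_empty] at h1
      omega
    obtain ⟨g, hg, hw⟩ := Nat.sInf_mem hne
    exact sat_of_wrdf hm g hg (hw.trans h1)
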